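/- Let G be a finite group and let A be a commutative ring whose underlying additive group is torsion-free (for every nonzero natural number n and every a ∈ A, n•a = 0 implies a = 0). Let O denote the set of conjugacy classes of subgroups of G (the quotient of the set of subgroups of G by the conjugation action of G). For subgroups H, K of G let m(H, K) denote the number of H-fixed points of the left translation action of H on the coset space G/K, i.e. the number of cosets gK with H ≤ gKg⁻¹; this number depends only on the conjugacy classes of H and K. Define the ghost map Φ : Map(O, A) → Map(O, A) by Φ(α)([H]) = Σ_{[K] ∈ O} m(H, K) · α([K])^(|K|/|H|), where the exponent is the natural-number quotient |K|/|H| (note that m(H, K) = 0 unless H is conjugate to a subgroup of K, in which case |H| divides |K|, so the formula is well defined and independent of the chosen representatives). Then Φ is injective. -/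

import Mathlib

open Pointwise

variable (G : Type u) [Group G] [Finite G]

/-- The set of conjugacy classes of subgroups of `G`: the quotient of the set of subgroups
of `G` by the conjugation action of `G`. -/
abbrev SubgroupConjClasses : Type u :=
  Quotient (MulAction.orbitRel (ConjAct G) (Subgroup G))

/-- `m(H, K)`: the number of `H`-fixed points of the left translation action of the
subgroup `H` on the coset space `G/K`. -/
noncomputable def subgroupFixedCard (H K : Subgroup G) : ℕ :=
  Nat.card (MulAction.fixedPoints H (G ⧸ K))

/-- The ghost map `Φ : Map(O, A) → Map(O, A)`,
`Φ(α)([H]) = Σ_{[K]} m(H, K) · α([K])^(|K|/|H|)`, where the sum runs over the conjugacy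
classes of subgroups of `G`, `m(H, K)` is the number of `H`-fixed points of `G/K`, and
the exponent is the natural-number quotient `|K|/|H|`. -/
noncomputable def ghostMap (A : Type v) [CommRing A]
    (α : SubgroupConjClasses G → A) : SubgroupConjClasses G → A :=
  fun q => ∑ᶠ q' : SubgroupConjClasses G,
    (subgroupFixedCard G q.out q'.out) •
      (α q' ^ (Nat.card q'.out / Nat.card q.out : ℕ))

theorem exists_le_conj_of_subgroupFixedCard_ne_zero {H K : Subgroup G}
    (h : subgroupFixedCard G H K ≠ 0) : ∃ g : ConjAct G, H ≤ g • K := by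
  obtain ⟨⟨x, hx⟩⟩ : Nonempty (MulAction.fixedPoints H (G ⧸ K)) :=
    (Nat.card_ne_zero.mp h).1
  obtain ⟨g, rfl⟩ := QuotientGroup.mk_surjective x
  refine ⟨ConjAct.toConjAct g, fun y hy => ?_⟩
  have hfix : ((y * g : G) : G ⧸ K) = (g : G ⧸ K) := hx ⟨y, hy⟩
  rw [Subgroup.mem_pointwise_smul_iff_inv_smul_mem, ← ConjAct.toConjAct_inv,
    ConjAct.toConjAct_smul, inv_inv]
  simpa [mul_assoc] using QuotientGroup.eq.mp hfix.symm

theorem subgroupFixedCard_self_ne_zero (H : Subgroup G) : subgroupFixedCard G H H ≠ 0 := by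
  refine Nat.card_ne_zero.mpr ⟨⟨((1 : G) : G ⧸ H), fun h => ?_⟩, inferInstance⟩
  change (((h : G) * 1 : G) : G ⧸ H) = ((1 : G) : G ⧸ H)
  exact QuotientGroup.eq.mpr (by simp)

theorem card_lt_card_of_subgroupFixedCard_ne_zero {q q' : SubgroupConjClasses G}
    (h : subgroupFixedCard G q.out q'.out ≠ 0) (hne : q' ≠ q) :
    Nat.card q.out < Nat.card q'.out := by
  obtain ⟨g, hg⟩ := exists_le_conj_of_subgroupFixedCard_ne_zero G h
  have hcard : Nat.card (g • q'.out : Subgroup G) = Nat.card q'.out :=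
    (Nat.card_congr (Subgroup.equivSMul g q'.out).toEquiv).symm
  by_contra hlt
  have heq : q.out = g • q'.out :=
    Subgroup.eq_of_le_of_card_ge hg (hcard.trans_le (not_lt.mp hlt))
  refine hne ?_
  rw [← Quotient.out_eq q, ← Quotient.out_eq q']
  exact (Quotient.sound (MulAction.orbitRel_apply.mpr ⟨g, heq.symm⟩)).symm

/-- For a finite group `G` and a commutative ring `A` whose additive group is torsion-free,
the ghost map on `G`-typical Witt vector ghost components is injective. -/
theorem ghostMap_injective (A : Type v) [CommRing A]
    (htf : ∀ n : ℕ, n ≠ 0 → ∀ a : A, n • a = 0 → a = 0) :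
    Function.Injective (ghostMap G A) := by
  intro α β h
  have : Fintype (SubgroupConjClasses G) := Fintype.ofFinite _
  suffices H : ∀ n (q : SubgroupConjClasses G), Nat.card G - Nat.card q.out = n → α q = β q from
    funext fun q => H _ q rfl
  intro n
  induction n using Nat.strong_induction_on with
  | _ n ih =>
  intro q hq
  have hΦ := congrFun h q
  simp only [ghostMap, finsum_eq_sum_of_fintype] at hΦ
  rw [← sub_eq_zero, ← Finset.sum_sub_distrib, Finset.sum_eq_single q] at hΦ
  · rw [Nat.div_self Nat.card_pos, pow_one, pow_one, ← nsmul_sub] at hΦ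
    exact sub_eq_zero.mp (htf _ (subgroupFixedCard_self_ne_zero G _) _ hΦ)
  · intro q' _ hne
    by_cases hm : subgroupFixedCard G q.out q'.out = 0
    · simp [hm]
    · have hlt := card_lt_card_of_subgroupFixedCard_ne_zero G hm hne
      have hle := Subgroup.card_le_card_group q'.out
      rw [ih _ (by omega) q' rfl, sub_self]
  · simp
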